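/- arXiv:1608.01390 — 2 statements merged into one kernel-verified Lean document; each statement's English description precedes it below -/
import Mathlib

section
/- Let K be an imaginary quadratic field, let L₁ and L₂ be rank-1 K-lattices of conductors f₁ and f₂, set f = lcm(f₁, f₂), and let F be a positive integer divisible by f. Suppose 0 → L₂ → L → L₁ → 0 is a short exact sequence of O_F-modules whose class in Ext¹_{O_F}(L₁, L₂) has order n. Then L is ℤ-free of rank 4, the K-vector space L ⊗_ℤ ℚ (with K acting through the O_F-structure) is 2-dimensional over K, and the multiplier ring {α ∈ K : α·L ⊆ L inside L ⊗_ℤ ℚ} equals the order O_{n·f} of conductor n·lcm(f₁, f₂). -/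
open CategoryTheory
open scoped TensorProduct

noncomputable section

variable (K : Type) [Field K] [NumberField K]

/-- The underlying set of the order `ℤ + m·O_K` of conductor `m` in `K`. -/
def orderSet (m : ℕ) : Set K :=
  {x : K | ∃ (a : ℤ) (y : NumberField.RingOfIntegers K),
    x = (a : K) + (m : K) * algebraMap (NumberField.RingOfIntegers K) K y}

/-- The order `ℤ + m·O_K` of conductor `m`, as a subring of `K`. -/
def orderSubring (m : ℕ) : Subring K where
  carrier := orderSet K m
  add_mem' := by
    rintro x y ⟨a, u, rfl⟩ ⟨b, v, rfl⟩
    exact ⟨a + b, u + v, by rw [map_add]; push_cast; ring⟩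
  zero_mem' := ⟨0, 0, by simp⟩
  one_mem' := ⟨1, 0, by simp⟩
  neg_mem' := by
    rintro x ⟨a, u, rfl⟩
    exact ⟨-a, -u, by rw [map_neg]; push_cast; ring⟩
  mul_mem' := by
    rintro x y ⟨a, u, rfl⟩ ⟨b, v, rfl⟩
    refine ⟨a * b, a • v + b • u + (m : ℤ) • (u * v), ?_⟩
    rw [map_add, map_add, map_zsmul, map_zsmul, map_zsmul, map_mul]
    rw [zsmul_eq_mul, zsmul_eq_mul, zsmul_eq_mul]
    push_cast
    ring

/-- `L` is a rank-1 `K`-lattice: a finitely generated `ℤ`-submodule of `K`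
spanning `K` over `ℚ`. -/
def IsLat (L : Submodule ℤ K) : Prop :=
  L.FG ∧ Submodule.span ℚ (L : Set K) = ⊤

/-- The multiplier ring `R(L) = {α ∈ K : α·L ⊆ L}` of a lattice, as a `ℤ`-submodule. -/
def multLat (L : Submodule ℤ K) : Submodule ℤ K where
  carrier := {α : K | ∀ x ∈ L, α * x ∈ L}
  add_mem' := by
    intro a b ha hb x hx
    rw [add_mul]; exact L.add_mem (ha x hx) (hb x hx)
  zero_mem' := by intro x hx; rw [zero_mul]; exact L.zero_mem
  smul_mem' := by
    intro n a ha x hx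
    rw [smul_mul_assoc]; exact L.smul_mem n (ha x hx)

/-- `L` has conductor `c`, i.e. the multiplier ring of `L` is the order `ℤ + c·O_K`. -/
def HasCond (L : Submodule ℤ K) (c : ℕ) : Prop :=
  0 < c ∧ (multLat K L : Set K) = orderSet K c

/-- A lattice `L` with `R·L ⊆ L` is a module over the subring `R ⊆ K`. -/
def latticeModule (R : Subring K) (L : Submodule ℤ K)
    (h : ∀ r ∈ R, ∀ x ∈ L, r * x ∈ L) : Module R L :=
  { smul := fun r x => ⟨(r : K) * (x : K), h r r.2 x x.2⟩
    one_smul := fun x => by ext; exact one_mul _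
    mul_smul := fun r s x => by ext; exact mul_assoc _ _ _
    smul_zero := fun r => by ext; exact mul_zero _
    smul_add := fun r x y => by ext; exact mul_add _ _ _
    add_smul := fun r s x => by ext; exact add_mul _ _ _
    zero_smul := fun x => by ext; exact zero_mul _ }

/-- A lattice `L` stable under the subring `R ⊆ K`, as an object of `ModuleCat R`. -/
def latMod (R : Subring K) (L : Submodule ℤ K)
    (h : ∀ r ∈ R, ∀ x ∈ L, r * x ∈ L) : ModuleCat R := by
  letI := latticeModule K R L h
  exact ModuleCat.of R L

section Commutator

variable {L₁ L₂ : Type*} [AddCommGroup L₁] [AddCommGroup L₂]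

/-- The map `h ↦ θ₂ ∘ h - h ∘ θ₁` on `ℤ`-linear maps `L₁ → L₂`. -/
def commutatorMap (θ₁ : Module.End ℤ L₁) (θ₂ : Module.End ℤ L₂) :
    (L₁ →ₗ[ℤ] L₂) →ₗ[ℤ] (L₁ →ₗ[ℤ] L₂) where
  toFun h := θ₂ ∘ₗ h - h ∘ₗ θ₁
  map_add' h h' := by ext x; simp; abel
  map_smul' k h := by ext x; simp [smul_sub]

@[simp]
theorem commutatorMap_apply (θ₁ : Module.End ℤ L₁) (θ₂ : Module.End ℤ L₂) (h : L₁ →ₗ[ℤ] L₂)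
    (x : L₁) : commutatorMap θ₁ θ₂ h x = θ₂ (h x) - h (θ₁ x) := rfl

theorem smul_mem_range_commutatorMap_of_source_basis (θ₁ : Module.End ℤ L₁)
    (θ₂ : Module.End ℤ L₂) (D : L₁ →ₗ[ℤ] L₂) (e : Module.Basis (Fin 2) ℤ L₁) {a b c d : ℤ}
    (h0 : θ₁ (e 0) = a • e 0 + c • e 1) (h1 : θ₁ (e 1) = b • e 0 + d • e 1)
    (hD : ∀ y, D (θ₁ y) = (a + d) • D y - θ₂ (D y)) :
    b • D ∈ LinearMap.range (commutatorMap θ₁ θ₂) ∧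
      c • D ∈ LinearMap.range (commutatorMap θ₁ θ₂) ∧
      (d - a) • D ∈ LinearMap.range (commutatorMap θ₁ θ₂) := by
  have D0 := hD (e 0)
  have D1 := hD (e 1)
  rw [h0, map_add, map_smul, map_smul, eq_sub_iff_add_eq', ← eq_sub_iff_add_eq] at D0
  rw [h1, map_add, map_smul, map_smul, eq_sub_iff_add_eq', ← eq_sub_iff_add_eq] at D1
  refine ⟨⟨e.constr ℤ ![-D (e 1), 0], ?_⟩, ⟨e.constr ℤ ![0, -D (e 0)], ?_⟩,
    ⟨e.constr ℤ ![D (e 0), -D (e 1)], ?_⟩⟩ <;>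
  · refine e.ext fun j => ?_
    fin_cases j <;> simp [h0, h1, D0, D1] <;> module

theorem smul_mem_range_commutatorMap_of_target_basis (θ₁ : Module.End ℤ L₁)
    (θ₂ : Module.End ℤ L₂) (D : L₁ →ₗ[ℤ] L₂) (v : Module.Basis (Fin 2) ℤ L₂) {a b c d : ℤ}
    (h0 : θ₂ (v 0) = a • v 0 + c • v 1) (h1 : θ₂ (v 1) = b • v 0 + d • v 1)
    (hD : ∀ y, D (θ₁ y) = (a + d) • D y - θ₂ (D y)) :
    b • D ∈ LinearMap.range (commutatorMap θ₁ θ₂) ∧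
      c • D ∈ LinearMap.range (commutatorMap θ₁ θ₂) ∧
      (d - a) • D ∈ LinearMap.range (commutatorMap θ₁ θ₂) := by
  have hexp : ∀ y, D y = v.coord 0 (D y) • v 0 + v.coord 1 (D y) • v 1 := fun y => by
    have h := v.sum_repr (D y)
    rw [Fin.sum_univ_two] at h
    exact h.symm
  have hθ : ∀ y, D (θ₁ y) = (d * v.coord 0 (D y) - b * v.coord 1 (D y)) • v 0
      + (a * v.coord 1 (D y) - c * v.coord 0 (D y)) • v 1 := fun y => by
    have h := hexp y
    generalize v.coord 0 (D y) = s at h ⊢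
    generalize v.coord 1 (D y) = t at h ⊢
    rw [hD, h]
    simp only [map_add, map_smul, h0, h1]
    module
  have hc0 : ∀ y, v.coord 0 (D (θ₁ y)) = d * v.coord 0 (D y) - b * v.coord 1 (D y) :=
    fun y => by rw [hθ]; simp
  have hc1 : ∀ y, v.coord 1 (D (θ₁ y)) = a * v.coord 1 (D y) - c * v.coord 0 (D y) :=
    fun y => by rw [hθ]; simp
  refine ⟨⟨((v.coord 0).comp D).smulRight (v 1), ?_⟩,
    ⟨((v.coord 1).comp D).smulRight (v 0), ?_⟩,
    ⟨((v.coord 1).comp D).smulRight (v 1) - ((v.coord 0).comp D).smulRight (v 0), ?_⟩⟩ <;>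
  · ext y
    rw [LinearMap.smul_apply, hexp y]
    simp only [commutatorMap_apply, LinearMap.sub_apply, LinearMap.smulRight_apply,
      LinearMap.comp_apply, hc0, hc1, map_sub, map_smul, h0, h1]
    module

end Commutator

section ExtClass

open CategoryTheory Abelian

theorem smul_extClass_eq_zero_iff {C : Type*} [Category* C] [Abelian C] [HasExt C]
    {S : ShortComplex C} (hS : S.ShortExact) (k : ℤ) :
    k • hS.extClass = 0 ↔ ∃ φ : S.X₃ ⟶ S.X₂, φ ≫ S.g = k • 𝟙 S.X₃ := by
  have key : (Ext.mk₀ (k • 𝟙 S.X₃)).comp hS.extClass (zero_add 1) = k • hS.extClass := by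
    have h := map_zsmul (AddMonoidHom.mk' (fun φ : S.X₃ ⟶ S.X₃ =>
      (Ext.mk₀ φ).comp hS.extClass (zero_add 1)) fun φ ψ => by
      rw [Ext.mk₀_add, Ext.add_comp]) k (𝟙 S.X₃)
    simpa using h
  constructor
  · intro h
    obtain ⟨x₂, hx₂⟩ := Ext.covariant_sequence_exact₃ _ hS (Ext.mk₀ (k • 𝟙 S.X₃)) (zero_add 1)
      (key.trans h)
    obtain ⟨φ, rfl⟩ := (Ext.mk₀_bijective _ _).2 x₂
    refine ⟨φ, (Ext.mk₀_bijective _ _).1 ?_⟩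
    rw [← hx₂, Ext.mk₀_comp_mk₀]
  · rintro ⟨φ, hφ⟩
    rw [← key, ← hφ, ← Ext.mk₀_comp_mk₀, Ext.comp_assoc_of_second_deg_zero, hS.comp_extClass,
      Ext.comp_zero]

end ExtClass

section Orders

open NumberField

theorem IsLat.exists_basis (hdeg : Module.finrank ℚ K = 2) {L : Submodule ℤ K} (hL : IsLat K L) :
    Nonempty (Module.Basis (Fin 2) ℤ L) := by
  have : L.IsLattice ℚ := ⟨hL.1, hL.2⟩
  have : Module.Free ℤ L := Submodule.IsLattice.free ℚ L
  have h : Module.finrank ℤ L = Module.finrank ℚ K :=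
    congrArg Cardinal.toNat (Submodule.IsLattice.rank' ℚ L)
  exact ⟨Module.finBasisOfFinrankEq ℤ L (h.trans hdeg)⟩

theorem exists_generator_ringOfIntegers (hdeg : Module.finrank ℚ K = 2) :
    ∃ w : K, (∃ t m : ℤ, w * w = t * w - m) ∧ (∀ a b : ℤ, (a : K) + b * w = 0 → a = 0 ∧ b = 0) ∧
      ∀ (m : ℕ) (x : K), x ∈ orderSet K m ↔ ∃ a b : ℤ, x = a + m * b * w := by
  obtain ⟨e⟩ : Nonempty (Module.Basis (Fin 2) ℤ (𝓞 K)) :=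
    ⟨Module.finBasisOfFinrankEq ℤ _ ((RingOfIntegers.rank K).trans hdeg)⟩
  have h1 : (1 : 𝓞 K) = e.repr 1 0 • e 0 + e.repr 1 1 • e 1 := by
    simpa [Fin.sum_univ_two] using (e.sum_repr 1).symm
  set x := e.repr 1 0
  set y := e.repr 1 1
  have hcop : IsCoprime x y := by
    refine IsRelPrime.isCoprime ?_
    rintro d ⟨x', hx⟩ ⟨y', hy⟩
    refine isUnit_of_map_unit (algebraMap ℤ (𝓞 K)) d ?_
    refine IsUnit.of_mul_eq_one (x' • e 0 + y' • e 1) ?_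
    rw [h1, hx, hy, ← Algebra.smul_def, smul_add, smul_smul, smul_smul]
  obtain ⟨u, v, huv⟩ := hcop
  set ω : 𝓞 K := u • e 1 - v • e 0 with hω
  have he0 : e 0 = u • 1 - y • ω := by
    rw [h1, hω]
    linear_combination (norm := module) (-huv) • e 0
  have he1 : e 1 = v • 1 + x • ω := by
    rw [h1, hω]
    linear_combination (norm := module) (-huv) • e 1
  have hspan : ∀ z : 𝓞 K, ∃ a b : ℤ, z = a + b * ω := fun z => by
    refine ⟨e.repr z 0 * u + e.repr z 1 * v, e.repr z 1 * x - e.repr z 0 * y, ?_⟩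
    have h := e.sum_repr z
    rw [Fin.sum_univ_two, he0, he1] at h
    simp only [zsmul_eq_mul] at h
    push_cast
    linear_combination -h
  have hind : ∀ a b : ℤ, (a : 𝓞 K) + b * ω = 0 → a = 0 ∧ b = 0 := fun a b hab => by
    have h : (a * x - b * v) • e 0 + (a * y + b * u) • e 1 = 0 := by
      rw [← hab, hω, ← mul_one (a : 𝓞 K), ← zsmul_eq_mul, ← zsmul_eq_mul, h1]
      module
    have hli := Fintype.linearIndependent_iff.1 e.linearIndependent ![a * x - b * v, a * y + b * u]
      (by simpa [Fin.sum_univ_two] using h)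
    have hx := hli 0
    have hy := hli 1
    simp only [Matrix.cons_val_zero, Matrix.cons_val_one] at hx hy
    constructor
    · linear_combination u * hx + v * hy - a * huv
    · linear_combination x * hy - y * hx - b * huv
  refine ⟨algebraMap (𝓞 K) K ω, ?_, fun a b hab => hind a b ?_, fun m z => ⟨?_, ?_⟩⟩
  · obtain ⟨a, b, hab⟩ := hspan (ω * ω)
    refine ⟨b, -a, ?_⟩
    rw [← map_mul, hab]
    simp only [map_add, map_mul, map_intCast]
    push_cast
    ring
  · exact RingOfIntegers.coe_injective (by simpa using hab)
  · rintro ⟨a, y, rfl⟩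
    obtain ⟨b, c, rfl⟩ := hspan y
    refine ⟨a + m * b, c, ?_⟩
    simp only [map_add, map_mul, map_intCast]
    push_cast
    ring
  · rintro ⟨a, b, rfl⟩
    refine ⟨a, b * ω, ?_⟩
    simp only [map_mul, map_intCast]
    ring

theorem exists_mul_mem_orderSet {F : ℕ} (hF : 0 < F) (z : K) :
    ∃ N : ℤ, N ≠ 0 ∧ (N : K) * z ∈ orderSet K F := by
  obtain ⟨y, hy0, hy⟩ := ((IsFractionRing.isAlgebraic_iff ℤ ℚ K).2
    (Algebra.IsAlgebraic.isAlgebraic z)).exists_integral_multiple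
  obtain ⟨u, hu⟩ : ∃ u : 𝓞 K, algebraMap (𝓞 K) K u = y • z := ⟨⟨_, hy⟩, rfl⟩
  refine ⟨F * y, by positivity, 0, u, ?_⟩
  rw [hu, zsmul_eq_mul]
  push_cast
  ring

theorem isFractionRing_orderSubring {F : ℕ} (hF : 0 < F) :
    IsFractionRing (orderSubring K F) K := by
  refine IsFractionRing.of_field _ _ fun z => ?_
  obtain ⟨N, hN, hz⟩ := exists_mul_mem_orderSet K hF z
  refine ⟨⟨_, hz⟩, N, ?_⟩
  have : (N : K) ≠ 0 := by exact_mod_cast hN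
  rw [map_intCast, eq_div_iff this]
  exact mul_comm _ _

variable {K} in
theorem exists_basis_matrix (hdeg : Module.finrank ℚ K = 2) {w : K} {t m : ℤ}
    (hw : w * w = t * w - m) (hind : ∀ a b : ℤ, (a : K) + b * w = 0 → a = 0 ∧ b = 0)
    (hord : ∀ (m : ℕ) (x : K), x ∈ orderSet K m ↔ ∃ a b : ℤ, x = a + m * b * w)
    {L : Submodule ℤ K} (hL : IsLat K L) {c₀ : ℕ} (hc : HasCond K L c₀) {f : ℕ} (hf : 0 < f)
    (θ : Module.End ℤ L) (hθ : ∀ y, (θ y : K) = f * w * y) :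
    ∃ (e : Module.Basis (Fin 2) ℤ L) (a b c d : ℤ),
      θ (e 0) = a • e 0 + c • e 1 ∧ θ (e 1) = b • e 0 + d • e 1 ∧ a + d = f * t ∧
      ∀ k : ℤ, k ∣ b → k ∣ c → k ∣ d - a → k * c₀ ∣ f := by
  obtain ⟨e⟩ := hL.exists_basis K hdeg
  have hexp : ∀ y : L, y = e.repr y 0 • e 0 + e.repr y 1 • e 1 := fun y => by
    have h := e.sum_repr y
    rw [Fin.sum_univ_two] at h
    exact h.symm
  refine ⟨e, e.repr (θ (e 0)) 0, e.repr (θ (e 1)) 0, e.repr (θ (e 0)) 1, e.repr (θ (e 1)) 1,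
    hexp _, hexp _, ?_⟩
  have h0 := hexp (θ (e 0))
  have h1 := hexp (θ (e 1))
  generalize e.repr (θ (e 0)) 0 = a at h0 ⊢
  generalize e.repr (θ (e 1)) 0 = b at h1 ⊢
  generalize e.repr (θ (e 0)) 1 = c at h0 ⊢
  generalize e.repr (θ (e 1)) 1 = d at h1 ⊢
  apply_fun (Subtype.val : L → K) at h0 h1
  simp only [hθ, Submodule.coe_add, Submodule.coe_smul, zsmul_eq_mul] at h0 h1
  have hne : (e 1 : K) ≠ 0 := fun h => e.ne_zero 1 (Subtype.ext h)
  have hfK : (f : ℤ) ≠ 0 := by exact_mod_cast hf.ne'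
  refine ⟨?_, fun k ⟨b', hb⟩ ⟨c', hc'⟩ ⟨d', hd⟩ => ?_⟩
  · have hchar : (f * w - a) * (f * w - d) = (b * c : K) := by
      apply mul_right_cancel₀ hne
      linear_combination (f * w - a : K) * h1 + (b : K) * h0
    obtain ⟨-, h⟩ := hind (a * d - b * c - f * f * m) (f * (f * t - (a + d))) (by
      push_cast
      linear_combination hchar - (f : K) * f * hw)
    have := (mul_eq_zero.1 h).resolve_left hfK
    linarith
  · have hk : k ≠ 0 := by
      rintro rfl
      rw [zero_mul] at hb hc' hd
      rw [hc'] at h0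
      have hne : (e 0 : K) ≠ 0 := fun h => e.ne_zero 0 (Subtype.ext h)
      obtain ⟨-, h⟩ := hind (-a) f (by
        apply mul_right_cancel₀ hne
        push_cast at h0 ⊢
        linear_combination h0)
      exact hfK h
    have hkK : (k : K) ≠ 0 := by exact_mod_cast hk
    have hb2 : (b : K) = k * b' := by exact_mod_cast hb
    have hc2 : (c : K) = k * c' := by exact_mod_cast hc'
    have hd2 : (d : K) - a = k * d' := by exact_mod_cast hd
    have hmem : (f * w - a) / k ∈ multLat K L := by
      intro x hx
      have hy := hexp ⟨x, hx⟩
      generalize e.repr ⟨x, hx⟩ 0 = r at hy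
      generalize e.repr ⟨x, hx⟩ 1 = s at hy
      apply_fun (Subtype.val : L → K) at hy
      simp only [Submodule.coe_add, Submodule.coe_smul, zsmul_eq_mul] at hy
      have : (f * w - a) / k * x =
          ((s * b') • e 0 + (r * c' + s * d') • e 1 : L) := by
        simp only [Submodule.coe_add, Submodule.coe_smul, zsmul_eq_mul]
        rw [hy, div_mul_eq_mul_div, div_eq_iff hkK]
        push_cast
        linear_combination (r : K) * h0 + (s : K) * h1 + (s : K) * (e 0 : K) * hb2 +
          (r : K) * (e 1 : K) * hc2 + (s : K) * (e 1 : K) * hd2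
      rw [this]
      exact Subtype.coe_prop _
    rw [← SetLike.mem_coe, hc.2, hord] at hmem
    obtain ⟨r, s, hrs⟩ := hmem
    rw [div_eq_iff hkK] at hrs
    obtain ⟨-, h⟩ := hind (-a - k * r) (f - k * c₀ * s) (by
      push_cast
      linear_combination hrs)
    exact ⟨s, by linarith⟩

variable {K} in
/-- A form of `Ext¹(L₁, L₂) = 0` over the order of conductor `lcm f₁ f₂`. -/
theorem mem_range_commutatorMap (hdeg : Module.finrank ℚ K = 2) {w : K} {t m : ℤ}
    (hw : w * w = t * w - m) (hind : ∀ a b : ℤ, (a : K) + b * w = 0 → a = 0 ∧ b = 0)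
    (hord : ∀ (m : ℕ) (x : K), x ∈ orderSet K m ↔ ∃ a b : ℤ, x = a + m * b * w)
    {L₁ L₂ : Submodule ℤ K} (hL₁ : IsLat K L₁) (hL₂ : IsLat K L₂) {f₁ f₂ : ℕ}
    (hc₁ : HasCond K L₁ f₁) (hc₂ : HasCond K L₂ f₂)
    (θ₁ : Module.End ℤ L₁) (hθ₁ : ∀ y, (θ₁ y : K) = (f₁.lcm f₂ : ℕ) * w * y)
    (θ₂ : Module.End ℤ L₂) (hθ₂ : ∀ y, (θ₂ y : K) = (f₁.lcm f₂ : ℕ) * w * y)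
    (D : L₁ →ₗ[ℤ] L₂) (hD : ∀ y, D (θ₁ y) = ((f₁.lcm f₂ : ℕ) * t) • D y - θ₂ (D y)) :
    D ∈ LinearMap.range (commutatorMap θ₁ θ₂) := by
  have hf : 0 < f₁.lcm f₂ := Nat.lcm_pos hc₁.1 hc₂.1
  obtain ⟨e, a, b, c, d, h0, h1, ht, hdvd⟩ :=
    exists_basis_matrix hdeg hw hind hord hL₁ hc₁ hf θ₁ hθ₁
  obtain ⟨v, a', b', c', d', h0', h1', ht', hdvd'⟩ :=
    exists_basis_matrix hdeg hw hind hord hL₂ hc₂ hf θ₂ hθ₂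
  obtain ⟨hb, hc, hd⟩ := smul_mem_range_commutatorMap_of_source_basis θ₁ θ₂ D e h0 h1
    (by rwa [ht])
  obtain ⟨hb', hc', hd'⟩ := smul_mem_range_commutatorMap_of_target_basis θ₁ θ₂ D v h0' h1'
    (by rwa [ht'])
  let J : Ideal ℤ :=
    (LinearMap.range (commutatorMap θ₁ θ₂)).comap (LinearMap.toSpanSingleton ℤ _ D)
  have hJ : ∀ {k : ℤ}, k • D ∈ LinearMap.range (commutatorMap θ₁ θ₂) →
      Submodule.IsPrincipal.generator J ∣ k := fun h =>
    (Submodule.IsPrincipal.mem_iff_generator_dvd J).1 h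
  set k := Submodule.IsPrincipal.generator J
  have hk₁ := hdvd k (hJ hb) (hJ hc) (hJ hd)
  have hk₂ := hdvd' k (hJ hb') (hJ hc') (hJ hd')
  rw [← Int.natAbs_dvd_natAbs, Int.natAbs_mul, Int.natAbs_natCast, Int.natAbs_natCast] at hk₁ hk₂
  have hlcm := Nat.lcm_dvd hk₁ hk₂
  rw [Nat.lcm_mul_left] at hlcm
  have hunit : IsUnit k := by
    rw [Int.isUnit_iff_natAbs_eq]
    exact Nat.eq_one_of_dvd_one ((Nat.mul_dvd_mul_iff_right hf).1 (by rwa [one_mul]))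
  have hmem : (1 : ℤ) ∈ J :=
    (Submodule.IsPrincipal.mem_iff_generator_dvd J).2 hunit.dvd
  simpa [J] using hmem

end Orders

section Multiplier

variable {K}

theorem map_eq_smul_of_coe_eq_mul {F : ℕ} (hF : 0 < F) {L : Submodule ℤ K}
    {V : Type*} [AddCommGroup V] [Module K V] (g : L →ₗ[ℤ] V)
    (hg : ∀ r ∈ orderSet K F, ∀ x x' : L, (x' : K) = r * x → g x' = r • g x)
    {α : K} {x x' : L} (hx : (x' : K) = α * x) : g x' = α • g x := by
  obtain ⟨N, hN, hα⟩ := exists_mul_mem_orderSet K hF α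
  have hNK : (N : K) ≠ 0 := by exact_mod_cast hN
  have h := hg _ hα x (N • x') (by
    rw [Submodule.coe_smul, zsmul_eq_mul, hx, mul_assoc])
  rw [map_smul, ← Int.cast_smul_eq_zsmul K, mul_smul] at h
  exact smul_right_injective V hNK h

/-- Multiplication by `α` as an endomorphism of a lattice stable under `α`. -/
def mulEnd (L : Submodule ℤ K) (α : K) (h : α ∈ multLat K L) : Module.End ℤ L :=
  (LinearMap.mulLeft ℤ α).restrict h

omit [NumberField K] in
@[simp]
theorem coe_mulEnd_apply (L : Submodule ℤ K) (α : K) (h : α ∈ multLat K L) (x : L) :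
    (mulEnd L α h x : K) = α * x := rfl

variable {L₁ L₂ : Submodule ℤ K} {M V : Type*} [AddCommGroup M] [AddCommGroup V] [Module K V]
  {F : ℕ} {i : L₂ →ₗ[ℤ] M} {p : M →ₗ[ℤ] L₁} {ι : M →ₗ[ℤ] V} {P : V →ₗ[K] K}

theorem mem_multLat_of_exact (hF : 0 < F) (h₂ : ∀ r ∈ orderSet K F, ∀ x ∈ L₂, r * x ∈ L₂)
    (hi_inj : Function.Injective i) (hex : Function.Exact i p) (hp : Function.Surjective p)
    (hι : Function.Injective ι)
    (hi : ∀ r ∈ orderSet K F, ∀ x x' : L₂, (x' : K) = r * x → ι (i x') = r • ι (i x))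
    (hP : ∀ x, P (ι x) = p x) {α : K} (hα : ∀ x, ∃ y, α • ι x = ι y) :
    α ∈ multLat K L₁ ∧ α ∈ multLat K L₂ := by
  refine ⟨fun y hy => ?_, fun l hl => ?_⟩
  · obtain ⟨x, hx⟩ := hp ⟨y, hy⟩
    obtain ⟨z, hz⟩ := hα x
    have h := congrArg P hz
    rw [map_smul, hP, hP, hx, smul_eq_mul] at h
    rw [h]
    exact Subtype.coe_prop _
  · obtain ⟨z, hz⟩ := hα (i ⟨l, hl⟩)
    have h := congrArg P hz
    rw [map_smul, hP, hP, hex.apply_apply_eq_zero, ZeroMemClass.coe_zero, smul_zero] at h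
    obtain ⟨l', rfl⟩ := (hex z).1 (Subtype.ext h.symm)
    obtain ⟨N, hN, hNα⟩ := exists_mul_mem_orderSet K hF α
    have hNK : (N : K) ≠ 0 := by exact_mod_cast hN
    have h := hi _ hNα ⟨l, hl⟩ ⟨_, h₂ _ hNα l hl⟩ rfl
    rw [mul_smul, hz, Int.cast_smul_eq_zsmul, ← map_smul, ← map_smul] at h
    have h : (N : K) * α * l = ((N • l' : L₂) : K) := congrArg Subtype.val (hi_inj (hι h))
    rw [Submodule.coe_smul, zsmul_eq_mul, mul_assoc] at h
    rw [mul_left_cancel₀ hNK h]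
    exact Subtype.coe_prop _

theorem exists_linear_of_smul_mem (hdeg : Module.finrank ℚ K = 2) {w : K} {t m : ℤ}
    (hw : w * w = t * w - m) (hind : ∀ a b : ℤ, (a : K) + b * w = 0 → a = 0 ∧ b = 0)
    (hord : ∀ (m : ℕ) (x : K), x ∈ orderSet K m ↔ ∃ a b : ℤ, x = a + m * b * w)
    (hL₁ : IsLat K L₁) (hL₂ : IsLat K L₂) {f₁ f₂ : ℕ}
    (hc₁ : HasCond K L₁ f₁) (hc₂ : HasCond K L₂ f₂) (hF : 0 < F) (hfF : f₁.lcm f₂ ∣ F)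
    (hi_inj : Function.Injective i) (hex : Function.Exact i p) (hp : Function.Surjective p)
    (hι : Function.Injective ι)
    (hi : ∀ r ∈ orderSet K F, ∀ x x' : L₂, (x' : K) = r * x → ι (i x') = r • ι (i x))
    (hP : ∀ x, P (ι x) = p x)
    (hθ₁ : (f₁.lcm f₂ : ℕ) * w ∈ multLat K L₁) (hθ₂ : (f₁.lcm f₂ : ℕ) * w ∈ multLat K L₂) {b : ℤ}
    (hb : ∀ x, ∃ y, (b * ((f₁.lcm f₂ : ℕ) * w) : K) • ι x = ι y) :
    ∃ φ : L₁ →ₗ[ℤ] M, (∀ r ∈ orderSet K F, ∀ x x' : L₁, (x' : K) = r * x →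
      ι (φ x') = r • ι (φ x)) ∧ ∀ y, p (φ y) = b • y := by
  obtain ⟨e⟩ := hL₁.exists_basis K hdeg
  have : Module.Free ℤ L₁ := Module.Free.of_basis e
  obtain ⟨s, hs⟩ := Module.projective_lifting_property p LinearMap.id hp
  have hs : ∀ y, p (s y) = y := fun y => LinearMap.congr_fun hs y
  set f := f₁.lcm f₂
  set θ₁ := mulEnd L₁ _ hθ₁ with hθ₁_def
  set θ₂ := mulEnd L₂ _ hθ₂
  have hθi : ∀ l, ι (i (θ₂ l)) = (f * w : K) • ι (i l) := fun l =>
    map_eq_smul_of_coe_eq_mul hF (ι ∘ₗ i) hi (coe_mulEnd_apply L₂ _ hθ₂ l)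
  have hD : ∀ y, ∃ l, ι (i l) = (b : K) • ((f * w : K) • ι (s y) - ι (s (θ₁ y))) := fun y => by
    obtain ⟨z, hz⟩ := hb (s y)
    have hpz : p (z - s (b • θ₁ y)) = 0 := by
      have h := congrArg P hz
      rw [map_smul, hP, hP, hs, smul_eq_mul] at h
      rw [map_sub, hs, sub_eq_zero]
      refine Subtype.ext ?_
      rw [← h, Submodule.coe_smul, coe_mulEnd_apply, zsmul_eq_mul]
      ring
    obtain ⟨l, hl⟩ := (hex _).1 hpz
    refine ⟨l, ?_⟩
    rw [hl, map_sub, ← hz, map_smul, map_smul, ← Int.cast_smul_eq_zsmul K, mul_smul, smul_sub]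
  choose D₀ hD₀ using hD
  have hιi : Function.Injective fun l => ι (i l) := hι.comp hi_inj
  let D : L₁ →ₗ[ℤ] L₂ := (AddMonoidHom.mk' D₀ fun x y => hιi (by
    simp only [map_add, hD₀]
    module)).toIntLinearMap
  have hD : ∀ y, ι (i (D y)) = (b : K) • ((f * w : K) • ι (s y) - ι (s (θ₁ y))) := hD₀
  have hconj : ∀ y, D (θ₁ y) = (f * t) • D y - θ₂ (D y) := fun y => hιi (by
    have hsq : θ₁ (θ₁ y) = ((f : ℤ) * t) • θ₁ y - ((f : ℤ) * f * m) • y := by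
      refine Subtype.ext ?_
      simp only [hθ₁_def, coe_mulEnd_apply, Submodule.coe_sub, Submodule.coe_smul, zsmul_eq_mul]
      push_cast
      linear_combination (f * f * y : K) * hw
    simp only [map_sub, map_smul, hθi, hD, hsq]
    simp only [← Int.cast_smul_eq_zsmul K]
    push_cast
    linear_combination (norm := module) ((b : K) * f * f * hw) • ι (s y))
  obtain ⟨h, hh⟩ := mem_range_commutatorMap hdeg hw hind hord hL₁ hL₂ hc₁ hc₂ θ₁
    (coe_mulEnd_apply L₁ _ hθ₁) θ₂ (coe_mulEnd_apply L₂ _ hθ₂) D hconj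
  have hφθ : ∀ y, ι ((b • s - i ∘ₗ h) (θ₁ y)) = (f * w : K) • ι ((b • s - i ∘ₗ h) y) :=
    fun y => by
      have h1 := hD y
      rw [← hh, commutatorMap_apply, map_sub, map_sub, hθi] at h1
      simp only [LinearMap.sub_apply, LinearMap.smul_apply, LinearMap.comp_apply, map_sub, map_smul]
      simp only [← Int.cast_smul_eq_zsmul K]
      linear_combination (norm := module) h1
  refine ⟨b • s - i ∘ₗ h, fun r hr x x' hx => ?_, fun y => ?_⟩
  · obtain ⟨g, hg⟩ := hfF
    obtain ⟨a, c, rfl⟩ := (hord _ _).1 hr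
    have hx' : x' = a • x + (g * c) • θ₁ x := by
      refine Subtype.ext ?_
      rw [hx, hg]
      simp only [hθ₁_def, coe_mulEnd_apply, Submodule.coe_add, Submodule.coe_smul, zsmul_eq_mul]
      push_cast
      ring
    rw [hx', map_add, map_add, map_smul, map_smul, map_smul, map_smul, hφθ, hg]
    simp only [← Int.cast_smul_eq_zsmul K]
    push_cast
    module
  · simp [hs, hex.apply_apply_eq_zero]

theorem setOf_smul_mem_eq_orderSet (hdeg : Module.finrank ℚ K = 2)
    (hL₁ : IsLat K L₁) (hL₂ : IsLat K L₂) {f₁ f₂ : ℕ}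
    (hc₁ : HasCond K L₁ f₁) (hc₂ : HasCond K L₂ f₂) (hF : 0 < F) (hfF : f₁.lcm f₂ ∣ F)
    (h₂ : ∀ r ∈ orderSet K F, ∀ x ∈ L₂, r * x ∈ L₂)
    (hi_inj : Function.Injective i) (hex : Function.Exact i p) (hp : Function.Surjective p)
    (hι : Function.Injective ι)
    (hi : ∀ r ∈ orderSet K F, ∀ x x' : L₂, (x' : K) = r * x → ι (i x') = r • ι (i x))
    (hP : ∀ x, P (ι x) = p x) {n : ℕ}
    (hn : ∀ k : ℤ, (n : ℤ) ∣ k ↔ ∃ φ : L₁ →ₗ[ℤ] M, (∀ r ∈ orderSet K F, ∀ x x' : L₁,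
      (x' : K) = r * x → ι (φ x') = r • ι (φ x)) ∧ ∀ y, p (φ y) = k • y) :
    {α : K | ∀ x, ∃ y, α • ι x = ι y} = orderSet K (n * f₁.lcm f₂) := by
  obtain ⟨w, ⟨t, m, hw⟩, hind, hord⟩ := exists_generator_ringOfIntegers K hdeg
  have hθ : ∀ {L : Submodule ℤ K} {c : ℕ}, HasCond K L c → c ∣ f₁.lcm f₂ →
      (f₁.lcm f₂ : ℕ) * w ∈ multLat K L := by
    rintro L c hc ⟨g, hg⟩
    rw [← SetLike.mem_coe, hc.2, hord, hg]
    exact ⟨0, g, by push_cast; ring⟩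
  have hθ₁ := hθ hc₁ (Nat.dvd_lcm_left _ _)
  have hθ₂ := hθ hc₂ (Nat.dvd_lcm_right _ _)
  ext α
  rw [Set.mem_ofPred_eq, hord]
  constructor
  · intro hα
    obtain ⟨hα₁, hα₂⟩ := mem_multLat_of_exact hF h₂ hi_inj hex hp hι hi hP hα
    rw [← SetLike.mem_coe, hc₁.2, hord] at hα₁
    rw [← SetLike.mem_coe, hc₂.2, hord] at hα₂
    obtain ⟨a, b₁, rfl⟩ := hα₁
    obtain ⟨a', b₂, hab⟩ := hα₂
    obtain ⟨-, hb⟩ := hind (a - a') (f₁ * b₁ - f₂ * b₂) (by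
      push_cast
      linear_combination hab)
    obtain ⟨b, hb⟩ : ((f₁.lcm f₂ : ℕ) : ℤ) ∣ f₁ * b₁ := by
      rw [Int.natCast_dvd]
      refine Nat.lcm_dvd (Int.natCast_dvd.1 (dvd_mul_right _ _))
        (Int.natCast_dvd.1 ⟨b₂, by linarith⟩)
    have hbK : (f₁ * b₁ : K) = (f₁.lcm f₂ : ℕ) * b := by exact_mod_cast hb
    obtain ⟨k, rfl⟩ := (hn b).2 (exists_linear_of_smul_mem hdeg hw hind hord hL₁ hL₂ hc₁ hc₂ hF hfF
      hi_inj hex hp hι hi hP hθ₁ hθ₂ fun x => by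
        obtain ⟨y, hy⟩ := hα x
        refine ⟨y - a • x, ?_⟩
        rw [map_sub, map_smul, ← hy, hbK, ← Int.cast_smul_eq_zsmul K]
        module)
    refine ⟨a, k, ?_⟩
    rw [hbK]
    push_cast
    ring
  · rintro ⟨a, b, rfl⟩ x
    obtain ⟨φ, hφ, hpφ⟩ := (hn n).1 dvd_rfl
    have hker : p ((n : ℤ) • x - φ (p x)) = 0 := by
      rw [map_sub, map_smul, hpφ, sub_self]
    obtain ⟨l, hl⟩ := (hex _).1 hker
    refine ⟨a • x + b • φ (mulEnd L₁ _ hθ₁ (p x)) + b • i (mulEnd L₂ _ hθ₂ l), ?_⟩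
    have h1 := map_eq_smul_of_coe_eq_mul hF (ι ∘ₗ φ) hφ (coe_mulEnd_apply L₁ _ hθ₁ (p x))
    have h2 := map_eq_smul_of_coe_eq_mul hF (ι ∘ₗ i) hi (coe_mulEnd_apply L₂ _ hθ₂ l)
    rw [LinearMap.comp_apply, LinearMap.comp_apply] at h1 h2
    rw [hl, map_sub, map_smul] at h2
    simp only [map_add, map_smul, h1, h2]
    simp only [← Int.cast_smul_eq_zsmul K]
    push_cast
    module

end Multiplier

section Rank

variable {K}

omit [NumberField K] in
theorem isTorsionFree_orderSubring {F : ℕ} {L₁ L₂ : Submodule ℤ K} {M : Type*}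
    [AddCommGroup M] [Module (orderSubring K F) M] (i : L₂ →+ M) (p : M →+ L₁)
    (hi : ∀ (r : orderSubring K F) (x x' : L₂), (x' : K) = r * x → i x' = r • i x)
    (hi_inj : Function.Injective i) (hex : Function.Exact i p)
    (h₂ : ∀ r ∈ orderSet K F, ∀ x ∈ L₂, r * x ∈ L₂)
    (hp : ∀ (r : orderSubring K F) (x : M), (p (r • x) : K) = r * p x) :
    Module.IsTorsionFree (orderSubring K F) M := by
  refine Module.IsTorsionFree.of_smul_eq_zero fun r x h => ?_
  by_cases hr : r = 0
  · exact .inl hr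
  have hrK : (r : K) ≠ 0 := fun h => hr (Subtype.ext h)
  have h0 := hp r x
  rw [h, map_zero, ZeroMemClass.coe_zero, eq_comm, mul_eq_zero, or_iff_right hrK] at h0
  obtain ⟨l, rfl⟩ := (hex x).1 (Subtype.ext h0)
  rw [← hi r l ⟨_, h₂ _ r.2 _ l.2⟩ rfl, ← map_zero i] at h
  have h : (r : K) * l = 0 := congrArg Subtype.val (hi_inj h)
  rw [mul_eq_zero, or_iff_right hrK] at h
  refine .inr ?_
  rw [show l = 0 from Subtype.ext h, map_zero]

theorem rank_eq_one_of_injective {F : ℕ} (hF : 0 < F) {N : Type} [AddCommGroup N]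
    [Module (orderSubring K F) N] [Nontrivial N] (g : N →ₗ[orderSubring K F] K)
    (hg : Function.Injective g) : Module.rank (orderSubring K F) N = 1 := by
  have := isFractionRing_orderSubring K hF
  refine le_antisymm ?_ ?_
  · refine (g.rank_le_of_injective hg).trans ?_
    rw [← IsFractionRing.rank_right_eq (orderSubring K F) K K, Module.rank_self]
  · have : Module.IsTorsionFree (orderSubring K F) N := hg.moduleIsTorsionFree g (by simp)
    exact Cardinal.one_le_iff_pos.2 rank_pos

end Rank

/-- If `0 → L₂ → L → L₁ → 0` is a short exact sequence of `O_F`-modules whose class in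
`Ext¹_{O_F}(L₁, L₂)` has order `n`, then `L` is `ℤ`-free of rank `4`, `L ⊗ ℚ` (i.e.
`K ⊗_{O_F} L`) is `2`-dimensional over `K`, and the multiplier ring of `L` is the
order of conductor `n·lcm(f₁, f₂)`. -/
theorem middle_of_extension_structure
    (hdeg : Module.finrank ℚ K = 2)
    (himag : IsEmpty (K →+* ℝ))
    (L₁ L₂ : Submodule ℤ K) (hL₁ : IsLat K L₁) (hL₂ : IsLat K L₂)
    (f₁ f₂ : ℕ) (hc₁ : HasCond K L₁ f₁) (hc₂ : HasCond K L₂ f₂)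
    (f : ℕ) (hf : f = Nat.lcm f₁ f₂)
    (F : ℕ) (hF0 : 0 < F) (hF : f ∣ F)
    (R : Subring K) (hR : R = orderSubring K F)
    (h₁ : ∀ r ∈ R, ∀ x ∈ L₁, r * x ∈ L₁)
    (h₂ : ∀ r ∈ R, ∀ x ∈ L₂, r * x ∈ L₂)
    (M : Type) [AddCommGroup M] [Module R M]
    (i : latMod K R L₂ h₂ ⟶ ModuleCat.of R M)
    (p : ModuleCat.of R M ⟶ latMod K R L₁ h₁)
    (hzero : i ≫ p = 0)
    (hS : (CategoryTheory.ShortComplex.mk i p hzero).ShortExact)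
    [CategoryTheory.HasExt.{1} (ModuleCat.{0} R)]
    (n : ℕ) (hn : addOrderOf hS.extClass = n) :
    Module.Free ℤ M ∧ Module.finrank ℤ M = 4 ∧
    Module.finrank K (K ⊗[R] M) = 2 ∧
    {α : K | ∀ x : M, ∃ y : M,
        α • ((1 : K) ⊗ₜ[R] x) = ((1 : K) ⊗ₜ[R] y : K ⊗[R] M)} =
      orderSet K (n * f) := by
  subst hR hf
  have hmono : Function.Injective i.hom := (ModuleCat.mono_iff_injective _).1 hS.mono_f
  have hepi : Function.Surjective p.hom := (ModuleCat.epi_iff_surjective _).1 hS.epi_g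
  have hexact := (ShortComplex.ShortExact.moduleCat_exact_iff_function_exact _).1 hS.exact
  let i' : L₂ →ₗ[ℤ] M := AddMonoidHom.toIntLinearMap ⟨⟨i.hom, i.hom.map_zero⟩, i.hom.map_add⟩
  let p' : M →ₗ[ℤ] L₁ := AddMonoidHom.toIntLinearMap ⟨⟨p.hom, p.hom.map_zero⟩, p.hom.map_add⟩
  have hi_inj : Function.Injective i' := hmono
  have hp_surj : Function.Surjective p' := hepi
  have hex : Function.Exact i' p' := hexact
  have hi : ∀ (r : orderSubring K F) (x x' : L₂), (x' : K) = r * x → i' x' = r • i' x := by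
    intro r x x' hx
    obtain rfl : x' = ⟨r * x, h₂ r r.2 x x.2⟩ := Subtype.ext hx
    exact i.hom.map_smul r x
  have hp : ∀ (r : orderSubring K F) (x : M), (p' (r • x) : K) = r * p' x := fun r x =>
    congrArg Subtype.val (p.hom.map_smul r x)
  have : Module.IsTorsionFree (orderSubring K F) M :=
    isTorsionFree_orderSubring i'.toAddMonoidHom p'.toAddMonoidHom hi hi_inj hex h₂ hp
  have := isFractionRing_orderSubring K hF0
  obtain ⟨e₁⟩ := hL₁.exists_basis K hdeg
  obtain ⟨e₂⟩ := hL₂.exists_basis K hdeg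
  have : Module.Free ℤ L₁ := Module.Free.of_basis e₁
  have : Module.Free ℤ L₂ := Module.Free.of_basis e₂
  have : Module.Finite ℤ L₁ := Module.Finite.of_basis e₁
  have : Module.Finite ℤ L₂ := Module.Finite.of_basis e₂
  obtain ⟨s, hs⟩ := Module.projective_lifting_property p' LinearMap.id hp_surj
  obtain ⟨e, -⟩ := hex.splitSurjectiveEquiv hi_inj ⟨s, hs⟩
  refine ⟨Module.Free.of_equiv e.symm, ?_, ?_, ?_⟩
  · rw [e.finrank_eq, Module.finrank_prod, Module.finrank_eq_card_basis e₁,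
      Module.finrank_eq_card_basis e₂, Fintype.card_fin]
  · have hrank : ∀ (L : Submodule ℤ K) (h : ∀ r ∈ orderSubring K F, ∀ x ∈ L, r * x ∈ L)
        (b : Module.Basis (Fin 2) ℤ L),
        Module.rank (orderSubring K F) (latMod K (orderSubring K F) L h) = 1 := fun L h b => by
      have : Nontrivial (latMod K (orderSubring K F) L h) := ⟨b 0, 0, b.ne_zero 0⟩
      exact rank_eq_one_of_injective hF0
        { toFun := fun x : L => (x : K), map_add' := fun _ _ => rfl, map_smul' := fun _ _ => rfl }
        Subtype.val_injective
    have hM := LinearMap.rank_range_add_rank_ker p.hom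
    rw [LinearMap.range_eq_top.2 hepi, rank_top, hrank L₁ h₁ e₁, hexact.linearMap_ker_eq,
      ← (LinearEquiv.ofInjective _ hmono).rank_eq, hrank L₂ h₂ e₂] at hM
    rw [(TensorProduct.isBaseChange (orderSubring K F) M K).finrank_eq]
    refine Module.finrank_eq_of_rank_eq ?_
    rw [← hM]
    norm_num
  · have hloc : IsLocalizedModule (nonZeroDivisors (orderSubring K F))
        (TensorProduct.mk (orderSubring K F) K M 1) :=
      (isLocalizedModule_iff_isBaseChange _ K _).2 (TensorProduct.isBaseChange _ M K)
    let ι : M →ₗ[ℤ] K ⊗[orderSubring K F] M :=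
      (TensorProduct.mk (orderSubring K F) K M 1).toAddMonoidHom.toIntLinearMap
    have hι : Function.Injective ι := fun x y hxy => by
      obtain ⟨c, hc⟩ := (IsLocalizedModule.eq_iff_exists (nonZeroDivisors (orderSubring K F))
        (TensorProduct.mk (orderSubring K F) K M 1)).1 hxy
      exact smul_right_injective M (nonZeroDivisors.coe_ne_zero c) hc
    have hιr : ∀ (r : orderSubring K F) (x : M), ι (r • x) = (r : K) • ι x := fun r x =>
      (TensorProduct.mk (orderSubring K F) K M 1).map_smul r x
    let P : K ⊗[orderSubring K F] M →ₗ[K] K := LinearMap.liftBaseChange K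
      { toFun := fun x => (p' x : K), map_add' := fun x y => by simp,
        map_smul' := hp }
    have hP : ∀ x, P (ι x) = p' x := fun x =>
      (LinearMap.liftBaseChange_tmul _ _ _ _).trans (one_smul _ _)
    refine setOf_smul_mem_eq_orderSet hdeg hL₁ hL₂ hc₁ hc₂ hF0 hF h₂ hi_inj hex hp_surj hι
      (fun r hr x x' hx => ?_) hP fun k => ?_
    · rw [hi ⟨r, hr⟩ x x' hx, hιr]
    · rw [← hn, addOrderOf_dvd_iff_zsmul_eq_zero, smul_extClass_eq_zero_iff]
      constructor
      · rintro ⟨φ, hφ⟩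
        refine ⟨AddMonoidHom.toIntLinearMap ⟨⟨φ.hom, φ.hom.map_zero⟩, φ.hom.map_add⟩,
          fun r hr x x' hx => ?_, fun y => ?_⟩
        · obtain rfl : x' = ⟨r * x, h₁ r hr x x.2⟩ := Subtype.ext hx
          exact (congrArg ι (φ.hom.map_smul ⟨r, hr⟩ x)).trans (hιr ⟨r, hr⟩ _)
        · exact congrArg (fun g => g.hom y) hφ
      · rintro ⟨φ, hφ, hpφ⟩
        refine ⟨ModuleCat.ofHom (X := latMod K (orderSubring K F) L₁ h₁) (Y := M)
          { toFun := φ, map_add' := φ.map_add, map_smul' := fun r x => hι ?_ }, ?_⟩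
        · exact (hφ r r.2 x ⟨r * (x : L₁).1, h₁ r r.2 _ (x : L₁).2⟩ rfl).trans (hιr r _).symm
        · ext y
          exact hpφ y

end
end

section
/- Let K be an imaginary quadratic field, let p be a prime, and let L ⊆ K be a rank-1 K-lattice of conductor 1 (i.e., a fractional O_K-ideal). There are exactly p + 1 rank-1 K-lattices L′ with L ⊆ L′ and L′/L of order p; among them, exactly 1 + χ_K(p) have conductor 1, and the remaining p − χ_K(p) have conductor p. -/
noncomputable section

variable (K : Type) [Field K] [NumberField K]

/-- The quotient group `L'/L`. -/
def quotLat (L L' : Submodule ℤ K) : Type :=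
  L' ⧸ (L.comap L'.subtype)

instance (L L' : Submodule ℤ K) : AddCommGroup (quotLat K L L') :=
  inferInstanceAs (AddCommGroup (L' ⧸ (L.comap L'.subtype)))

/-- The number of rank-1 `K`-lattices `L' ⊇ L` with `L'/L` of order `N` and `L'` of
conductor `b`. -/
def cntOrd (L : Submodule ℤ K) (b N : ℕ) : ℕ :=
  Nat.card {L' : Submodule ℤ K //
    L ≤ L' ∧ IsLat K L' ∧ Nat.card (quotLat K L L') = N ∧ HasCond K L' b}

/-- The rational prime `p` splits in `K`. -/
def SplitsIn (p : ℕ) : Prop :=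
  ∃ P Q : Ideal (NumberField.RingOfIntegers K), P.IsPrime ∧ Q.IsPrime ∧ P ≠ Q ∧
    Ideal.span {(p : NumberField.RingOfIntegers K)} = P * Q

/-- The rational prime `p` ramifies in `K`. -/
def RamifiesIn (p : ℕ) : Prop :=
  ∃ P : Ideal (NumberField.RingOfIntegers K), P.IsPrime ∧
    Ideal.span {(p : NumberField.RingOfIntegers K)} = P ^ 2

/-- The rational prime `p` is inert in `K`. -/
def InertIn (p : ℕ) : Prop :=
  (Ideal.span {(p : NumberField.RingOfIntegers K)}).IsPrime

section

set_option linter.unusedSectionVars false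

open Submodule

theorem ZMod.natCard_addSubgroups_of_natCard_eq_sq {V : Type*} [AddCommGroup V] {p : ℕ}
    [Module (ZMod p) V] (hp : p.Prime) (hV : Nat.card V = p ^ 2) :
    Nat.card {S : AddSubgroup V // Nat.card S = p} = p + 1 := by
  have : Fact p.Prime := ⟨hp⟩
  have : Finite V := Nat.finite_of_card_ne_zero (by rw [hV]; exact pow_ne_zero _ hp.ne_zero)
  have hcard (W : Type _) [AddCommGroup W] [Module (ZMod p) W] [Finite W] :
      Nat.card W = p ^ Module.finrank (ZMod p) W := by
    rw [Module.natCard_eq_pow_finrank (K := ZMod p), Nat.card_zmod]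
  have hinj : Function.Injective (p ^ ·) := Nat.pow_right_injective hp.two_le
  have hrank : Module.finrank (ZMod p) V = 2 := hinj ((hcard V).symm.trans hV)
  have hP := Projectivization.card_of_finrank_two (ZMod p) V hrank
  rw [Nat.card_zmod, Nat.card_congr (Projectivization.equivSubmodule _ _)] at hP
  rw [← hP]
  refine Nat.card_congr ((AddSubgroup.toZModSubmodule p).toEquiv.subtypeEquiv fun S ↦ ?_)
  have h : Nat.card S = p ^ Module.finrank (ZMod p) (AddSubgroup.toZModSubmodule p S) :=
    hcard (AddSubgroup.toZModSubmodule p S)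
  rw [h]
  exact (hinj.eq_iff (b := 1)).symm.trans (by simp) |>.symm

theorem AddCommGroup.natCard_addSubgroups_of_natCard_torsionBy {A : Type*} [AddCommGroup A]
    {p : ℕ} (hp : p.Prime) (hT : Nat.card (torsionBy ℤ A (p : ℤ)) = p ^ 2) :
    Nat.card {S : AddSubgroup A // Nat.card S = p} = p + 1 := by
  let T : AddSubgroup A := (torsionBy ℤ A (p : ℤ)).toAddSubgroup
  have hmem (x : A) : x ∈ T ↔ p • x = 0 := by
    simp only [T, mem_toAddSubgroup, mem_torsionBy_iff, natCast_zsmul]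
  let : Module (ZMod p) T := AddCommGroup.zmodModule fun x ↦ Subtype.ext ((hmem x).1 x.2)
  rw [← ZMod.natCard_addSubgroups_of_natCard_eq_sq (V := T) hp hT]
  have hf (H : AddSubgroup T) : Nat.card (H.map T.subtype) = Nat.card H :=
    Nat.card_image_of_injective Subtype.val_injective (H : Set T)
  refine (Nat.card_congr (Equiv.ofBijective 
    (fun H : {H : AddSubgroup T // Nat.card H = p} ↦
      (⟨H.1.map T.subtype, by rw [hf, H.2]⟩ : {S : AddSubgroup A // Nat.card S = p}))
    ⟨?_, ?_⟩)).symm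
  · rintro ⟨H, _⟩ ⟨H', _⟩ h
    exact Subtype.ext (AddSubgroup.map_injective T.subtype_injective (congrArg Subtype.val h))
  · rintro ⟨S, hS⟩
    have hST : S ≤ T := fun x hx ↦ by
      have : Nat.card S • (⟨x, hx⟩ : S) = 0 := card_nsmul_eq_zero'
      rw [hS] at this
      exact (hmem x).2 (congrArg Subtype.val this)
    have hH : (S.addSubgroupOf T).map T.subtype = S := by
      rw [AddSubgroup.addSubgroupOf_map_subtype, inf_eq_left.2 hST]
    exact ⟨⟨S.addSubgroupOf T, by rw [← hf, hH, hS]⟩, Subtype.ext hH⟩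

variable {K}

theorem natCard_quotLat (L L' : Submodule ℤ K) :
    Nat.card (quotLat K L L') = Nat.card (L'.map L.mkQ) := by
  have h := (L.mkQ.comp L'.subtype).quotKerEquivRange
  rw [LinearMap.range_comp, range_subtype, LinearMap.ker_comp, ker_mkQ] at h
  exact Nat.card_congr h.toEquiv

theorem natCard_superlattices (L : Submodule ℤ K) (n : ℕ) :
    Nat.card {L' : Submodule ℤ K // L ≤ L' ∧ Nat.card (quotLat K L L') = n} =
      Nat.card {S : Submodule ℤ (K ⧸ L) // Nat.card S = n} := by
  refine Nat.card_congr (Equiv.ofBijective (fun L' ↦ ⟨L'.1.map L.mkQ, ?_⟩) ⟨?_, ?_⟩)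
  · rw [← natCard_quotLat, L'.2.2]
  · rintro ⟨M, hM, _⟩ ⟨M', hM', _⟩ h
    have h := congrArg (fun S : Submodule ℤ (K ⧸ L) ↦ S.comap L.mkQ) (congrArg Subtype.val h)
    simp only [comap_map_mkQ, sup_eq_right.2 hM, sup_eq_right.2 hM'] at h
    exact Subtype.ext h
  · rintro ⟨S, hS⟩
    have h : (S.comap L.mkQ).map L.mkQ = S := map_comap_eq_of_surjective (mkQ_surjective L) S
    refine ⟨⟨S.comap L.mkQ, ?_, ?_⟩, Subtype.ext h⟩
    · simpa using comap_mono (f := L.mkQ) (bot_le (a := S))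
    · rw [natCard_quotLat, h, hS]

theorem IsLat.finrank_eq {L : Submodule ℤ K} (hL : IsLat K L) :
    Module.finrank ℤ L = Module.finrank ℚ K := by
  have : Module.Finite ℤ L := Module.Finite.iff_fg.2 hL.1
  let b := Module.Free.chooseBasis ℤ L
  have hli : LinearIndependent ℚ (fun i ↦ (b i : K)) := by
    rw [← LinearIndependent.iff_fractionRing ℤ ℚ]
    exact b.linearIndependent.map' L.subtype (ker_subtype _)
  have hsp : span ℤ (Set.range fun i ↦ (b i : K)) = L := by
    have := congrArg (Submodule.map L.subtype) b.span_eq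
    rwa [map_span, ← Set.range_comp, map_subtype_top] at this
  have htop : ⊤ ≤ span ℚ (Set.range fun i ↦ (b i : K)) := by
    rw [← hL.2, span_le]
    exact hsp.ge.trans (span_le_restrictScalars ℤ ℚ _)
  rw [Module.finrank_eq_card_basis (Module.Basis.mk hli htop), Module.finrank_eq_card_basis b]

theorem natCard_torsionBy_quotient {L : Submodule ℤ K} (hL : L.FG) {p : ℕ} (hp : p ≠ 0) :
    Nat.card (torsionBy ℤ (K ⧸ L) (p : ℤ)) = p ^ Module.finrank ℤ L := by
  have : Module.Finite ℤ L := Module.Finite.iff_fg.2 hL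
  have : NeZero p := ⟨hp⟩
  have hp0 : (p : K) ≠ 0 := Nat.cast_ne_zero.2 hp
  let d : K →ₗ[ℤ] K := (LinearMap.mulLeft ℤ ((p : K)⁻¹))
  let f : L →ₗ[ℤ] torsionBy ℤ (K ⧸ L) (p : ℤ) :=
    (L.mkQ.comp (d.comp L.subtype)).codRestrict _ fun x ↦ by
      rw [mem_torsionBy_iff, LinearMap.comp_apply, ← map_smul]
      simp [d, hp0, -map_smul, -zsmul_eq_mul, -map_nsmul]
  have hker : LinearMap.ker f = LinearMap.range (LinearMap.lsmul ℤ L (p : ℤ)) := by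
    ext x
    have : f x = 0 ↔ (p : K)⁻¹ * x ∈ L := by
      rw [← Subtype.coe_inj]; simp [f, d]
    rw [LinearMap.mem_ker, this]
    constructor
    · intro h
      exact ⟨⟨_, h⟩, Subtype.ext (by simp [hp0])⟩
    · rintro ⟨y, rfl⟩
      simp [hp0]
  have hsurj : Function.Surjective f := by
    rintro ⟨x, hx⟩
    obtain ⟨x, rfl⟩ := L.mkQ_surjective x
    rw [mem_torsionBy_iff, ← map_smul] at hx
    have hx : (p : K) * x ∈ L := by simpa using hx
    exact ⟨⟨_, hx⟩, Subtype.ext (by simp [f, d, hp0])⟩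
  rw [← ModN.natCard_eq L p]
  refine (Nat.card_congr (?_ : ModN L p ≃ _)).symm
  exact ((quotEquivOfEq _ _ hker.symm).trans (f.quotKerEquivOfSurjective hsurj)).toEquiv

theorem mem_comap_torsionBy_iff (L : Submodule ℤ K) (p : ℕ) {x : K} :
    x ∈ (torsionBy ℤ (K ⧸ L) (p : ℤ)).comap L.mkQ ↔ (p : K) * x ∈ L := by
  rw [mem_comap, mem_torsionBy_iff, ← map_smul]
  simp

theorem natCard_superlattices_eq {L : Submodule ℤ K} {p : ℕ} (hp : p.Prime)
    (hT : Nat.card (torsionBy ℤ (K ⧸ L) (p : ℤ)) = p ^ 2) :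
    Nat.card {L' : Submodule ℤ K // L ≤ L' ∧ Nat.card (quotLat K L L') = p} = p + 1 := by
  rw [natCard_superlattices, ← AddCommGroup.natCard_addSubgroups_of_natCard_torsionBy hp hT]
  exact Nat.card_congr (AddSubgroup.toIntSubmodule.toEquiv.subtypeEquiv fun S ↦ Iff.rfl).symm

/-- The overlattices of `L` of prime index `p` are the modules strictly between `L` and `p⁻¹L`. -/
theorem natCard_quotLat_eq_prime_iff {L L' : Submodule ℤ K} (hLL' : L ≤ L') {p : ℕ} (hp : p.Prime)
    (hT : Nat.card (torsionBy ℤ (K ⧸ L) (p : ℤ)) = p ^ 2) :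
    Nat.card (quotLat K L L') = p ↔
      L' ≠ L ∧ (∀ x ∈ L', (p : K) * x ∈ L) ∧ ∃ x ∉ L', (p : K) * x ∈ L := by
  set T := torsionBy ℤ (K ⧸ L) (p : ℤ)
  have hcomap : (L'.map L.mkQ).comap L.mkQ = L' := by
    rw [comap_map_mkQ, sup_eq_right.2 hLL']
  have hmem (x : K) : L.mkQ x ∈ L'.map L.mkQ ↔ x ∈ L' := by
    rw [← mem_comap, hcomap]
  have hle : L'.map L.mkQ ≤ T ↔ ∀ x ∈ L', (p : K) * x ∈ L := by
    rw [map_le_iff_le_comap]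
    exact forall₂_congr fun x _ ↦ mem_comap_torsionBy_iff L p
  have hTle : T ≤ L'.map L.mkQ ↔ ∀ x, (p : K) * x ∈ L → x ∈ L' := by
    refine ⟨fun h x hx ↦ (hmem x).1 (h ((mem_comap_torsionBy_iff L p).2 hx)), fun h y hy ↦ ?_⟩
    obtain ⟨x, rfl⟩ := L.mkQ_surjective y
    exact (hmem x).2 (h x ((mem_comap_torsionBy_iff L p).1 hy))
  have hbot : L'.map L.mkQ = ⊥ ↔ L' = L := by
    rw [← LinearMap.le_ker_iff_map, ker_mkQ]
    exact ⟨fun h ↦ h.antisymm hLL', fun h ↦ h.le⟩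
  have hT1 : Finite T :=
    Nat.finite_of_card_ne_zero (by rw [hT]; exact pow_ne_zero _ hp.ne_zero)
  rw [natCard_quotLat]
  constructor
  · intro h
    refine ⟨fun h' ↦ ?_, hle.1 fun y hy ↦ ?_, ?_⟩
    · rw [hbot.2 h', Nat.card_unique] at h
      exact hp.one_lt.ne h
    · have : Nat.card (L'.map L.mkQ) • (⟨y, hy⟩ : L'.map L.mkQ) = 0 := card_nsmul_eq_zero'
      rw [h] at this
      rw [mem_torsionBy_iff, natCast_zsmul]
      exact congrArg Subtype.val this
    · by_contra! hx
      have h2 := hTle.2 fun x hx' ↦ by_contra fun h'' ↦ hx x h'' hx'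
      have : Finite (L'.map L.mkQ) := Nat.finite_of_card_ne_zero (by rw [h]; exact hp.ne_zero)
      have h3 : Nat.card T ≤ Nat.card (L'.map L.mkQ) :=
        Nat.card_le_card_of_injective _ (inclusion_injective h2)
      rw [hT, h] at h3
      nlinarith [hp.two_le]
  · rintro ⟨h1, h2, x, hx, hxL⟩
    have h2 := hle.2 h2
    have hdvd : Nat.card (L'.map L.mkQ) ∣ p ^ 2 :=
      hT ▸ AddSubgroup.card_dvd_of_le (H := (L'.map L.mkQ).toAddSubgroup)
        (K := T.toAddSubgroup) h2
    obtain ⟨k, hk, hk'⟩ := (Nat.dvd_prime_pow hp).1 hdvd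
    interval_cases k
    · refine (h1 (hbot.1 ?_)).elim
      rw [pow_zero, Nat.card_eq_one_iff_unique] at hk'
      have := hk'.1
      exact eq_bot_of_subsingleton
    · rw [hk', pow_one]
    · refine (hx (hTle.1 ?_ x hxL)).elim
      have hs : ((L'.map L.mkQ : Submodule ℤ (K ⧸ L)) : Set (K ⧸ L)) = T :=
        Set.eq_of_subset_of_ncard_le h2 (by
          rw [← Nat.card_coe_set_eq, ← Nat.card_coe_set_eq]
          exact (hT.trans hk'.symm).le) (Set.toFinite (T : Set (K ⧸ L)))
      exact hs.ge

theorem IsLat.of_mul_mem {L L' : Submodule ℤ K} (hL : IsLat K L) (hLL' : L ≤ L') {p : ℕ}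
    (hp : p ≠ 0) (h : ∀ x ∈ L', (p : K) * x ∈ L) : IsLat K L' := by
  refine ⟨?_, top_le_iff.1 (hL.2 ▸ span_mono hLL')⟩
  refine FG.of_le (hL.1.map (LinearMap.mulLeft ℤ ((p : K)⁻¹))) fun x hx ↦ ⟨_, h x hx, ?_⟩
  simp [hp]

theorem IsLat.ne_bot {L : Submodule ℤ K} (hL : IsLat K L) : L ≠ ⊥ := by
  rintro rfl
  have := hL.2
  simp at this

theorem orderSet_one : orderSet K 1 = Set.range (algebraMap (NumberField.RingOfIntegers K) K) := by
  ext x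
  constructor
  · rintro ⟨a, y, rfl⟩
    exact ⟨a + y, by simp⟩
  · rintro ⟨y, rfl⟩
    exact ⟨0, y, by simp⟩

theorem IsLat.multLat_subset {L : Submodule ℤ K} (hL : IsLat K L) :
    (multLat K L : Set K) ⊆ Set.range (algebraMap (NumberField.RingOfIntegers K) K) := by
  intro α hα
  have : IsIntegral ℤ α := isIntegral_of_smul_mem_submodule L hL.ne_bot hL.1 α hα
  exact ⟨⟨α, this⟩, rfl⟩

theorem IsLat.hasCond_one_iff {L : Submodule ℤ K} (hL : IsLat K L) :
    HasCond K L 1 ↔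
      ∀ y : NumberField.RingOfIntegers K, ∀ x ∈ L, algebraMap _ K y * x ∈ L := by
  rw [HasCond, orderSet_one]
  constructor
  · rintro ⟨_, h⟩ y
    exact h.ge ⟨y, rfl⟩
  · refine fun h ↦ ⟨one_pos, hL.multLat_subset.antisymm ?_⟩
    rintro _ ⟨y, rfl⟩
    exact h y

open NumberField

variable (K) in
/-- The lattice `n • 𝓞 K`. -/
def natMulIntegers (n : ℕ) : Submodule ℤ K :=
  LinearMap.range ((LinearMap.mulLeft ℤ (n : K)).comp
    (algebraMap (𝓞 K) K).toIntAlgHom.toLinearMap)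

theorem mem_natMulIntegers {n : ℕ} {x : K} :
    x ∈ natMulIntegers K n ↔ ∃ y : 𝓞 K, (n : K) * algebraMap (𝓞 K) K y = x :=
  Iff.rfl

theorem natMul_mem_natMulIntegers {p : ℕ} (hp : p ≠ 0) {x : K} :
    (p : K) * x ∈ natMulIntegers K p ↔ x ∈ Set.range (algebraMap (𝓞 K) K) := by
  rw [mem_natMulIntegers]
  exact exists_congr fun y ↦ mul_right_inj' (Nat.cast_ne_zero.2 hp)

theorem natCard_torsionBy_natMulIntegers {p : ℕ} (hp : p ≠ 0) :
    Nat.card (torsionBy ℤ (K ⧸ natMulIntegers K p) (p : ℤ)) = p ^ Module.finrank ℚ K := by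
  have hinj : Function.Injective ((LinearMap.mulLeft ℤ (p : K)).comp
      (algebraMap (𝓞 K) K).toIntAlgHom.toLinearMap) := fun x y h ↦
    RingOfIntegers.coe_injective (mul_left_cancel₀ (Nat.cast_ne_zero.2 hp) h)
  have e : 𝓞 K ≃ₗ[ℤ] natMulIntegers K p := LinearEquiv.ofInjective _ hinj
  have hfg : (natMulIntegers K p).FG :=
    Module.Finite.iff_fg.1 (Module.Finite.equiv e)
  rw [natCard_torsionBy_quotient hfg hp, ← e.finrank_eq, RingOfIntegers.rank]

variable (K) in
/-- The order of conductor `m` as a `ℤ`-submodule of `K`. -/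
def orderLat (m : ℕ) : Submodule ℤ K :=
  span ℤ {1} ⊔ natMulIntegers K m

theorem coe_orderLat (m : ℕ) : (orderLat K m : Set K) = orderSet K m := by
  ext x
  simp only [orderLat, SetLike.mem_coe, mem_sup, mem_span_singleton, mem_natMulIntegers]
  constructor
  · rintro ⟨_, ⟨a, rfl⟩, _, ⟨y, rfl⟩, rfl⟩
    exact ⟨a, y, by simp⟩
  · rintro ⟨a, y, rfl⟩
    exact ⟨_, ⟨a, rfl⟩, _, ⟨y, rfl⟩, by simp⟩

theorem natMulIntegers_le_orderLat (m : ℕ) : natMulIntegers K m ≤ orderLat K m :=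
  le_sup_right

theorem one_mem_orderLat (m : ℕ) : (1 : K) ∈ orderLat K m :=
  mem_sup_left (mem_span_singleton_self 1)

theorem one_notMem_natMulIntegers {p : ℕ} (hp : p.Prime) :
    (1 : K) ∉ natMulIntegers K p := by
  rintro ⟨y, hy⟩
  have hy : (p : K) * algebraMap (𝓞 K) K y = 1 := hy
  have hT := natCard_torsionBy_natMulIntegers (K := K) hp.ne_zero
  have : torsionBy ℤ (K ⧸ natMulIntegers K p) (p : ℤ) = ⊥ := by
    refine (Submodule.eq_bot_iff _).2 fun t ht ↦ ?_
    obtain ⟨x, rfl⟩ := (natMulIntegers K p).mkQ_surjective t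
    have ht := (mem_comap_torsionBy_iff _ p).1 ht
    obtain ⟨z, rfl⟩ := (natMul_mem_natMulIntegers hp.ne_zero).1 ht
    rw [← LinearMap.mem_ker, ker_mkQ]
    exact ⟨y * z, by
      change (p : K) * algebraMap (𝓞 K) K (y * z) = _
      rw [map_mul, ← mul_assoc, hy, one_mul]⟩
  rw [this, Nat.card_unique] at hT
  exact (Nat.one_lt_pow Module.finrank_pos.ne' hp.one_lt).ne hT

theorem natCard_quotLat_orderLat {p : ℕ} (hp : p.Prime) :
    Nat.card (quotLat K (natMulIntegers K p) (orderLat K p)) = p := by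
  have : Fact p.Prime := ⟨hp⟩
  have hmap : (natMulIntegers K p).map (natMulIntegers K p).mkQ = ⊥ := by
    rw [← LinearMap.le_ker_iff_map, ker_mkQ]
  rw [natCard_quotLat, orderLat, Submodule.map_sup, map_span, Set.image_singleton, hmap,
    sup_bot_eq]
  have h : Nat.card (AddSubgroup.zmultiples ((natMulIntegers K p).mkQ 1)) = p := by
    rw [Nat.card_zmultiples]
    refine addOrderOf_eq_prime ?_ fun h ↦ one_notMem_natMulIntegers (K := K) hp ?_
    · rw [← map_nsmul, ← LinearMap.mem_ker, ker_mkQ]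
      exact ⟨1, by simp⟩
    · rwa [← LinearMap.mem_ker, ker_mkQ] at h
  exact (Nat.card_congr (Equiv.subtypeEquivRight fun x ↦ mem_span_singleton)).trans h

theorem eq_of_le_of_natCard_quotLat_eq {L M N : Submodule ℤ K} (hLM : L ≤ M) (hMN : M ≤ N)
    (hN : Nat.card (quotLat K L N) ≠ 0)
    (h : Nat.card (quotLat K L M) = Nat.card (quotLat K L N)) : M = N := by
  rw [natCard_quotLat] at hN
  rw [natCard_quotLat, natCard_quotLat] at h
  have hfin : Finite (N.map L.mkQ) := Nat.finite_of_card_ne_zero hN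
  have hs : ((M.map L.mkQ : Submodule ℤ (K ⧸ L)) : Set (K ⧸ L)) = N.map L.mkQ :=
    Set.eq_of_subset_of_ncard_le (map_mono hMN) (by
      rw [← Nat.card_coe_set_eq, ← Nat.card_coe_set_eq]
      exact h.ge) (Set.toFinite (N.map L.mkQ : Set (K ⧸ L)))
  have h := congrArg (fun S : Submodule ℤ (K ⧸ L) ↦ S.comap L.mkQ) (SetLike.coe_injective hs)
  simpa only [comap_map_mkQ, sup_eq_right.2 hLM, sup_eq_right.2 (hLM.trans hMN)] using h

theorem hasCond_prime_iff_not_hasCond_one (hdeg : Module.finrank ℚ K = 2) {p : ℕ} (hp : p.Prime)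
    {L M : Submodule ℤ K} (hL : ∀ y : 𝓞 K, ∀ x ∈ L, algebraMap (𝓞 K) K y * x ∈ L)
    (hM : IsLat K M) (hLM : L ≤ M) (hpM : ∀ x ∈ M, (p : K) * x ∈ L) :
    HasCond K M p ↔ ¬ HasCond K M 1 := by
  have hT := natCard_torsionBy_natMulIntegers (K := K) hp.ne_zero
  rw [hdeg] at hT
  have hO := (natCard_quotLat_eq_prime_iff (natMulIntegers_le_orderLat p) hp hT).1
    (natCard_quotLat_orderLat (K := K) hp)
  constructor
  · rintro ⟨_, h⟩ ⟨_, h'⟩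
    obtain ⟨x, hx, hx'⟩ := hO.2.2
    rw [natMul_mem_natMulIntegers hp.ne_zero, ← orderSet_one, ← h', h, ← coe_orderLat] at hx'
    exact hx hx'
  · intro h
    refine ⟨hp.pos, ?_⟩
    have hle : orderLat K p ≤ multLat K M := by
      refine sup_le ((span_singleton_le_iff_mem _ _).2 fun x hx ↦ by rwa [one_mul]) ?_
      rintro _ ⟨y, rfl⟩ x hx
      change (p : K) * algebraMap (𝓞 K) K y * x ∈ M
      rw [mul_comm (p : K), mul_assoc]
      exact hLM (hL y _ (hpM x hx))
    have hcard : Nat.card (quotLat K (natMulIntegers K p) (multLat K M)) = p := by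
      refine (natCard_quotLat_eq_prime_iff ((natMulIntegers_le_orderLat p).trans hle) hp hT).2
        ⟨fun h' ↦ ?_, fun x hx ↦ ?_, ?_⟩
      · exact one_notMem_natMulIntegers hp (h' ▸ hle (one_mem_orderLat p))
      · exact (natMul_mem_natMulIntegers hp.ne_zero).2 (hM.multLat_subset hx)
      · by_contra! h'
        refine h ⟨one_pos, ?_⟩
        rw [orderSet_one]
        refine hM.multLat_subset.antisymm fun x hx ↦ by_contra fun hx' ↦ h' x hx' ?_
        exact (natMul_mem_natMulIntegers hp.ne_zero).2 hx
    rw [← coe_orderLat, eq_of_le_of_natCard_quotLat_eq (natMulIntegers_le_orderLat p) hle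
      (by rw [hcard]; exact hp.ne_zero) (by rw [hcard, natCard_quotLat_orderLat hp])]

theorem IsDedekindDomain.setOf_mul_lt_lt_top {R : Type*} [CommRing R] [IsDedekindDomain R]
    {P Q : Ideal R} (hP : P.IsPrime) (hQ : Q.IsPrime) (hP0 : P ≠ ⊥) (hQ0 : Q ≠ ⊥) :
    {X : Ideal R | P * Q < X ∧ X < ⊤} = {P, Q} := by
  have hPi := (Ideal.prime_of_isPrime hP0 hP).irreducible
  have hQi := (Ideal.prime_of_isPrime hQ0 hQ).irreducible
  ext X
  simp only [Set.mem_ofPred_eq, Set.mem_insert_iff, Set.mem_singleton_iff]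
  constructor
  · rintro ⟨h1, h2⟩
    obtain ⟨A, B, hA, hB, rfl⟩ := (dvd_mul (k := X)).1 (Ideal.dvd_iff_le.2 h1.le)
    rw [hPi.dvd_iff, associated_iff_eq, Ideal.isUnit_iff] at hA
    rw [hQi.dvd_iff, associated_iff_eq, Ideal.isUnit_iff] at hB
    rcases hA with rfl | rfl <;> rcases hB with rfl | rfl
    · simp at h2
    · simp
    · simp
    · exact (lt_irrefl _ h1).elim
  · have key : ∀ {A B : Ideal R}, A.IsPrime → B.IsPrime → A ≠ ⊥ → A * B < A ∧ A < ⊤ := by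
      intro A B hA hB hA0
      refine ⟨lt_of_le_of_ne Ideal.mul_le_left fun h ↦ hB.ne_top ?_, lt_top_iff_ne_top.2 hA.ne_top⟩
      rw [← Ideal.one_eq_top]
      exact (mul_eq_left₀ hA0).1 h
    rintro (rfl | rfl)
    · exact key hP hQ hP0
    · rw [mul_comm]
      exact key hQ hP hQ0

theorem IsDedekindDomain.setOf_prime_lt_lt_top {R : Type*} [CommRing R] [IsDedekindDomain R]
    {P : Ideal R} (hP : P.IsPrime) (hP0 : P ≠ ⊥) : {X : Ideal R | P < X ∧ X < ⊤} = ∅ := by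
  refine Set.eq_empty_of_forall_notMem fun X hX ↦ ?_
  exact hX.1.ne ((hP.isMaximal hP0).eq_of_le hX.2.ne hX.1.le)

open scoped nonZeroDivisors

theorem IsLat.exists_fractionalIdeal {L : Submodule ℤ K} (hL : IsLat K L)
    (h : ∀ y : 𝓞 K, ∀ x ∈ L, algebraMap (𝓞 K) K y * x ∈ L) :
    ∃ J : FractionalIdeal (𝓞 K)⁰ K, ∀ x, x ∈ J ↔ x ∈ L := by
  let M : Submodule (𝓞 K) K :=
    { L.toAddSubmonoid with
      smul_mem' := fun y x hx ↦ by
        rw [Algebra.smul_def]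
        exact h y x hx }
  have hM : M.FG := FG.of_restrictScalars ℤ (by
    convert hL.1
    ext
    rfl)
  exact ⟨⟨M, FractionalIdeal.isFractional_of_fg hM⟩, fun x ↦ Iff.rfl⟩

theorem cntOrd_one_eq_natCard_fractionalIdeal {L : Submodule ℤ K} (hL : IsLat K L) {p : ℕ}
    (hp : p.Prime) (hT : Nat.card (torsionBy ℤ (K ⧸ L) (p : ℤ)) = p ^ 2)
    {I U : FractionalIdeal (𝓞 K)⁰ K} (hI : ∀ x, x ∈ I ↔ x ∈ L)
    (hU : ∀ x, x ∈ U ↔ (p : K) * x ∈ L) :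
    cntOrd K L 1 p = Nat.card {J : FractionalIdeal (𝓞 K)⁰ K // I < J ∧ J < U} := by
  let f (J : FractionalIdeal (𝓞 K)⁰ K) : Submodule ℤ K :=
    (J : Submodule (𝓞 K) K).restrictScalars ℤ
  have hf (J x) : x ∈ f J ↔ x ∈ J := Iff.rfl
  have hfJ (J) (h : I < J ∧ J < U) : L ≤ f J ∧ IsLat K (f J) ∧
      Nat.card (quotLat K L (f J)) = p ∧ HasCond K (f J) 1 := by
    have hLJ : L ≤ f J := fun x hx ↦ h.1.le ((hI x).2 hx)
    have hJ : ∀ x ∈ f J, (p : K) * x ∈ L := fun x hx ↦ (hU x).1 (h.2.le hx)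
    have hlat := hL.of_mul_mem hLJ hp.ne_zero hJ
    refine ⟨hLJ, hlat, (natCard_quotLat_eq_prime_iff hLJ hp hT).2 ⟨fun h' ↦ ?_, hJ, ?_⟩,
      hlat.hasCond_one_iff.2 fun y x hx ↦ ?_⟩
    · exact h.1.not_ge fun x hx ↦ (hI x).2 (h' ▸ hx)
    · obtain ⟨x, hx, hx'⟩ := SetLike.exists_of_lt h.2
      exact ⟨x, hx', (hU x).1 hx⟩
    · rw [← Algebra.smul_def]
      exact (J : Submodule (𝓞 K) K).smul_mem y hx
  symm
  refine Nat.card_congr (Equiv.ofBijective (fun J ↦ ⟨f J.1, hfJ J.1 J.2⟩) ⟨?_, ?_⟩)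
  · rintro ⟨J, _⟩ ⟨J', _⟩ h
    have h : f J = f J' := congrArg Subtype.val h
    exact Subtype.ext (SetLike.ext fun x ↦ by rw [← hf, h, hf])
  · rintro ⟨M, hLM, hM, hcard, hc⟩
    obtain ⟨J, hJ⟩ := hM.exists_fractionalIdeal (hM.hasCond_one_iff.1 hc)
    obtain ⟨h1, h2, x, hx, hx'⟩ := (natCard_quotLat_eq_prime_iff hLM hp hT).1 hcard
    refine ⟨⟨J, lt_of_le_not_ge (fun x hx ↦ (hJ x).2 (hLM ((hI x).1 hx))) fun h ↦ ?_,
      lt_of_le_not_ge (fun x hx ↦ (hU x).2 (h2 x ((hJ x).1 hx))) fun h ↦ ?_⟩,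
      Subtype.ext (SetLike.ext hJ)⟩
    · exact h1 (hLM.antisymm' fun x hx ↦ (hI x).1 (h ((hJ x).2 hx)))
    · exact hx ((hJ x).1 (h ((hU x).2 hx')))

theorem cntOrd_one_eq_ncard_ideal {L : Submodule ℤ K} (hL : IsLat K L) (hc : HasCond K L 1)
    {p : ℕ} (hp : p.Prime) (hT : Nat.card (torsionBy ℤ (K ⧸ L) (p : ℤ)) = p ^ 2) :
    cntOrd K L 1 p = {X : Ideal (𝓞 K) | Ideal.span {(p : 𝓞 K)} < X ∧ X < ⊤}.ncard := by
  have hp0 : (p : K) ≠ 0 := Nat.cast_ne_zero.2 hp.ne_zero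
  obtain ⟨I, hI⟩ := hL.exists_fractionalIdeal (hL.hasCond_one_iff.1 hc)
  have hI0 : I ≠ 0 := by
    rintro rfl
    refine hL.ne_bot ((Submodule.eq_bot_iff _).2 fun x hx ↦ ?_)
    exact (FractionalIdeal.mem_zero_iff _).1 ((hI x).2 hx)
  set s : FractionalIdeal (𝓞 K)⁰ K := FractionalIdeal.spanSingleton (𝓞 K)⁰ (p : K)⁻¹ with hs
  set U := s * I
  have hU (x) : x ∈ U ↔ (p : K) * x ∈ L := by
    rw [FractionalIdeal.mem_singleton_mul, ← hI]
    constructor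
    · rintro ⟨y, hy, rfl⟩
      rwa [mul_inv_cancel_left₀ hp0]
    · exact fun h ↦ ⟨_, h, by rw [inv_mul_cancel_left₀ hp0]⟩
  have hspan : ((Ideal.span {(p : 𝓞 K)} : Ideal (𝓞 K)) : FractionalIdeal (𝓞 K)⁰ K) * U = I := by
    rw [FractionalIdeal.coeIdeal_span_singleton, ← mul_assoc, hs,
      FractionalIdeal.spanSingleton_mul_spanSingleton, map_natCast, mul_inv_cancel₀ hp0,
      FractionalIdeal.spanSingleton_one, one_mul]
  have hU0 : U ≠ 0 := fun h ↦ hI0 (by rw [← hspan, h, mul_zero])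
  have hmul {A B : FractionalIdeal (𝓞 K)⁰ K} : A * U ≤ B * U ↔ A ≤ B := by
    refine ⟨fun h ↦ ?_, fun h ↦ by gcongr⟩
    have h : A * U * U⁻¹ ≤ B * U * U⁻¹ := by gcongr
    rwa [mul_inv_cancel_right₀ hU0, mul_inv_cancel_right₀ hU0] at h
  let f (X : Ideal (𝓞 K)) : FractionalIdeal (𝓞 K)⁰ K := X * U
  have hle (X Y) : f X ≤ f Y ↔ X ≤ Y :=
    hmul.trans (FractionalIdeal.coeIdeal_le_coeIdeal K)
  have hlt (X Y) : f X < f Y ↔ X < Y := by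
    rw [lt_iff_le_not_ge, lt_iff_le_not_ge, hle, hle]
  have htop : f ⊤ = U := by simp [f]
  rw [cntOrd_one_eq_natCard_fractionalIdeal hL hp hT hI hU, ← Nat.card_coe_set_eq]
  symm
  refine Nat.card_congr (Equiv.ofBijective (fun X ↦ ⟨f X.1, ?_, ?_⟩) ⟨?_, ?_⟩)
  · rw [← hspan]
    exact (hlt _ _).2 X.2.1
  · rw [← htop]
    exact (hlt _ _).2 X.2.2
  · rintro ⟨X, _⟩ ⟨Y, _⟩ h
    have h : f X = f Y := congrArg Subtype.val h
    exact Subtype.ext (((hle _ _).1 h.le).antisymm ((hle _ _).1 h.ge))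
  · rintro ⟨J, h1, h2⟩
    have hJ : J * U⁻¹ ≤ 1 := by
      rw [← mul_inv_cancel₀ hU0]
      gcongr
    obtain ⟨X, hX⟩ := FractionalIdeal.le_one_iff_exists_coeIdeal.1 hJ
    have hfX : f X = J := by
      simp only [f]
      rw [hX, inv_mul_cancel_right₀ hU0]
    refine ⟨⟨X, (hlt _ _).1 ?_, (hlt _ _).1 ?_⟩, Subtype.ext hfX⟩
    · rwa [hfX, show f (Ideal.span {(p : 𝓞 K)}) = I from hspan]
    · rwa [hfX, htop]

theorem ncard_ideals_between_span_natCast_and_top {p : ℕ} (hp : p ≠ 0) {χ : ℤ}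
    (hχ : (SplitsIn K p ∧ χ = 1) ∨ (RamifiesIn K p ∧ χ = 0) ∨ (InertIn K p ∧ χ = -1)) :
    ({X : Ideal (𝓞 K) | Ideal.span {(p : 𝓞 K)} < X ∧ X < ⊤}.ncard : ℤ) = 1 + χ := by
  have hp0 : Ideal.span {(p : 𝓞 K)} ≠ ⊥ := by
    rw [Ne, Ideal.span_singleton_eq_bot]
    exact Nat.cast_ne_zero.2 hp
  rcases hχ with ⟨⟨P, Q, hP, hQ, hPQ, h⟩, rfl⟩ | ⟨⟨P, hP, h⟩, rfl⟩ | ⟨h, rfl⟩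
  · rw [h] at hp0 ⊢
    rw [IsDedekindDomain.setOf_mul_lt_lt_top hP hQ (left_ne_zero_of_mul hp0)
      (right_ne_zero_of_mul hp0), Set.ncard_pair hPQ]
    norm_num
  · rw [h, pow_two] at hp0 ⊢
    rw [IsDedekindDomain.setOf_mul_lt_lt_top hP hP (left_ne_zero_of_mul hp0)
      (right_ne_zero_of_mul hp0), Set.pair_eq_singleton, Set.ncard_singleton]
    norm_num
  · rw [IsDedekindDomain.setOf_prime_lt_lt_top h hp0, Set.ncard_empty]
    norm_num

end

/-- A lattice of conductor `1` has exactly `p + 1` superlattices of index `p`; of these,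
`1 + χ_K(p)` have conductor `1` and `p − χ_K(p)` have conductor `p`. -/
theorem index_p_superlattices_of_maximal
    (hdeg : Module.finrank ℚ K = 2)
    (himag : IsEmpty (K →+* ℝ))
    (p : ℕ) (hp : p.Prime)
    (χ : ℤ)
    (hχ : (SplitsIn K p ∧ χ = 1) ∨ (RamifiesIn K p ∧ χ = 0) ∨
      (InertIn K p ∧ χ = -1))
    (L : Submodule ℤ K) (hL : IsLat K L) (hc : HasCond K L 1) :
    Nat.card {L' : Submodule ℤ K //
        L ≤ L' ∧ IsLat K L' ∧ Nat.card (quotLat K L L') = p} = p + 1 ∧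
    (cntOrd K L 1 p : ℤ) = 1 + χ ∧
    (cntOrd K L p p : ℤ) = p - χ := by
  have hT : Nat.card (Submodule.torsionBy ℤ (K ⧸ L) (p : ℤ)) = p ^ 2 := by
    rw [natCard_torsionBy_quotient hL.1 hp.ne_zero, hL.finrank_eq, hdeg]
  have hmul (L') (h : L ≤ L' ∧ Nat.card (quotLat K L L') = p) :
      ∀ x ∈ L', (p : K) * x ∈ L :=
    ((natCard_quotLat_eq_prime_iff h.1 hp hT).1 h.2).2.1
  have hlat (L') (h : L ≤ L' ∧ Nat.card (quotLat K L L') = p) : IsLat K L' :=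
    hL.of_mul_mem h.1 hp.ne_zero (hmul L' h)
  have htotal : Nat.card {L' : Submodule ℤ K //
      L ≤ L' ∧ IsLat K L' ∧ Nat.card (quotLat K L L') = p} = p + 1 := by
    rw [← natCard_superlattices_eq hp hT]
    exact Nat.card_congr (Equiv.subtypeEquivRight fun L' ↦
      ⟨fun h ↦ ⟨h.1, h.2.2⟩, fun h ↦ ⟨h.1, hlat L' h, h.2⟩⟩)
  have hone : (cntOrd K L 1 p : ℤ) = 1 + χ := by
    rw [cntOrd_one_eq_ncard_ideal hL hc hp hT,
      ncard_ideals_between_span_natCast_and_top hp.ne_zero hχ]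
  have hadd : cntOrd K L 1 p + cntOrd K L p p = p + 1 := by
    let S : Set (Submodule ℤ K) :=
      {L' | L ≤ L' ∧ IsLat K L' ∧ Nat.card (quotLat K L L') = p}
    have hS : S.ncard = p + 1 := (Nat.card_coe_set_eq S).symm.trans htotal
    have hfin : S.Finite := Set.finite_of_ncard_ne_zero (by rw [hS]; exact p.succ_ne_zero)
    rw [← hS, ← Set.ncard_inter_add_ncard_sdiff_eq_ncard S {L' | HasCond K L' 1} hfin,
      ← Nat.card_coe_set_eq, ← Nat.card_coe_set_eq]
    refine congrArg₂ (· + ·) ?_ ?_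
    · exact Nat.card_congr (Equiv.subtypeEquivRight fun L' ↦
        ⟨fun h ↦ ⟨⟨h.1, h.2.1, h.2.2.1⟩, h.2.2.2⟩,
          fun h ↦ ⟨h.1.1, h.1.2.1, h.1.2.2, h.2⟩⟩)
    · have key (L') (h : L' ∈ S) : HasCond K L' p ↔ ¬ HasCond K L' 1 :=
        hasCond_prime_iff_not_hasCond_one hdeg hp (hL.hasCond_one_iff.1 hc) h.2.1 h.1
          (hmul L' ⟨h.1, h.2.2⟩)
      exact Nat.card_congr (Equiv.subtypeEquivRight fun L' ↦
        ⟨fun h ↦ ⟨⟨h.1, h.2.1, h.2.2.1⟩, (key L' ⟨h.1, h.2.1, h.2.2.1⟩).1 h.2.2.2⟩,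
          fun h ↦ ⟨h.1.1, h.1.2.1, h.1.2.2, (key L' h.1).2 h.2⟩⟩)
  refine ⟨htotal, hone, ?_⟩
  zify at hadd
  linarith

end
end
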